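/- For every n ≥ 1 and every integer s with 0 ≤ s ≤ n, the number of vectors d ∈ F_2^{C(n,2)} expressible as d = v_{X_1} + ⋯ + v_{X_t} for some t ≤ n − s and subsets X_1, …, X_t ⊆ [n] is at most 2^{C(n,2)+n} · n^s · 2^{−C(s,2)}. Equivalently, every inversion ball of radius n − s in the space of labelled tournaments on [n] contains at most 2^{C(n,2)+n} · n^s · 2^{−C(s,2)} tournaments. -/

import Mathlib

open scoped BigOperators Classical

/-- Index type for the coordinates of `F_2^{C(n,2)}`: unordered pairs `{i,j} ⊆ [n]`,
represented as ordered pairs `(i,j)` with `i < j`. -/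
def PairIdx (n : ℕ) := {p : Fin n × Fin n // p.1 < p.2}

instance (n : ℕ) : Fintype (PairIdx n) := by unfold PairIdx; infer_instance
instance (n : ℕ) : DecidableEq (PairIdx n) := by unfold PairIdx; infer_instance

/-- The clique vector `v_X ∈ F_2^{C(n,2)}`: coordinate at `{i,j}` is `1` iff `{i,j} ⊆ X`. -/
def cliqueVec (n : ℕ) (X : Finset (Fin n)) : PairIdx n → ZMod 2 :=
  fun p => if p.1.1 ∈ X ∧ p.1.2 ∈ X then 1 else 0

/-- The pairs lying inside `J` are counted by `C(|J|, 2)`. -/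
theorem card_pairIdx_filter_mem (n : ℕ) (J : Finset (Fin n)) :
    (Finset.univ.filter (fun p : PairIdx n => p.1.1 ∈ J ∧ p.1.2 ∈ J)).card = J.card.choose 2 := by
  rw [← Finset.card_powersetCard]
  refine Finset.card_bij (fun p _ => {p.1.1, p.1.2}) ?_ ?_ ?_
  · rintro ⟨⟨a, b⟩, hab⟩ hp
    replace hp : a ∈ J ∧ b ∈ J := (Finset.mem_filter.1 hp).2
    refine Finset.mem_powersetCard.2 ⟨?_, Finset.card_pair (ne_of_lt hab)⟩
    intro x hx
    simp only [Finset.mem_insert, Finset.mem_singleton] at hx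
    rcases hx with rfl | rfl
    exacts [hp.1, hp.2]
  · rintro ⟨⟨a, b⟩, hab⟩ _ ⟨⟨c, d⟩, hcd⟩ _ h
    replace hab : a < b := hab
    replace hcd : c < d := hcd
    replace h : ({a, b} : Finset (Fin n)) = {c, d} := h
    have ha : a ∈ ({c, d} : Finset (Fin n)) := h ▸ by simp
    have hb : b ∈ ({c, d} : Finset (Fin n)) := h ▸ by simp
    simp only [Finset.mem_insert, Finset.mem_singleton] at ha hb
    apply Subtype.ext
    simp only [Prod.mk.injEq]
    omega
  · intro t ht
    obtain ⟨htJ, htc⟩ := Finset.mem_powersetCard.1 ht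
    obtain ⟨a, b, hab, rfl⟩ := Finset.card_eq_two.1 htc
    have ha : a ∈ J := htJ (by simp)
    have hb : b ∈ J := htJ (by simp)
    rcases lt_or_gt_of_ne hab with h | h
    · exact ⟨⟨(a, b), h⟩, Finset.mem_filter.2 ⟨Finset.mem_univ _, ha, hb⟩, rfl⟩
    · exact ⟨⟨(b, a), h⟩, Finset.mem_filter.2 ⟨Finset.mem_univ _, hb, ha⟩,
        Finset.pair_comm _ _⟩

theorem card_pairIdx (n : ℕ) : Fintype.card (PairIdx n) = n.choose 2 := by
  have h := card_pairIdx_filter_mem n Finset.univ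
  simpa using h

/-- A symmetric matrix whose rows are all combinations of the rows indexed by `I` is determined
by the rows indexed by `I`. -/
theorem symm_eq_of_rows_eq {ι R : Type*} [CommRing R] (I : Finset ι) (M N : ι → ι → R)
    (hM : ∀ i j, M i j = M j i) (hN : ∀ i j, N i j = N j i)
    (sM : ∀ j, ∃ c : ι → R, ∀ k, M j k = ∑ i ∈ I, c i * M i k)
    (sN : ∀ j, ∃ c : ι → R, ∀ k, N j k = ∑ i ∈ I, c i * N i k)
    (h : ∀ i ∈ I, ∀ k, M i k = N i k) : M = N := by
  funext j k
  obtain ⟨a, ha⟩ := sM j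
  obtain ⟨b, hb⟩ := sN k
  have key : ∀ i ∈ I, N k i = M k i := fun i hi => by rw [hN, hM, h i hi]
  calc M j k = ∑ i ∈ I, a i * M i k := ha k
    _ = ∑ i ∈ I, a i * ∑ l ∈ I, b l * N l i :=
        Finset.sum_congr rfl fun i hi => by rw [← hb i, key i hi, hM]
    _ = ∑ l ∈ I, b l * ∑ i ∈ I, a i * M i l := by
        simp only [Finset.mul_sum]
        rw [Finset.sum_comm]
        refine Finset.sum_congr rfl fun l hl => Finset.sum_congr rfl fun i hi => ?_
        rw [← h l hl i, hM l i]
        ring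
    _ = ∑ l ∈ I, b l * N l j :=
        Finset.sum_congr rfl fun l hl => by rw [← ha l, hM, h l hl]
    _ = N j k := by rw [← hb j, hN]

/-- Finitely many vectors in a space spanned by `r ≤ |ι|` vectors are spanned by some `r` of
them. -/
theorem exists_card_eq_forall_mem_span {ι K V : Type*} [Fintype ι] [Field K]
    [AddCommGroup V] [Module K V] (v : ι → V) {t r : ℕ} (x : Fin t → V) (htr : t ≤ r)
    (hr : r ≤ Fintype.card ι) (hv : ∀ j, v j ∈ Submodule.span K (Set.range x)) :
    ∃ I : Finset ι, I.card = r ∧ ∀ j, v j ∈ Submodule.span K (v '' I) := by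
  have hfin : Module.Finite K (Submodule.span K (Set.range x)) :=
    FiniteDimensional.span_of_finite K (Set.finite_range x)
  have hfin' : Module.Finite K (Submodule.span K (Set.range v)) :=
    FiniteDimensional.span_of_finite K (Set.finite_range v)
  have hle : Submodule.span K (Set.range v) ≤ Submodule.span K (Set.range x) :=
    Submodule.span_le.2 (by rintro _ ⟨j, rfl⟩; exact hv j)
  have hk : Module.finrank K (Submodule.span K (Set.range v)) ≤ t :=
    (Submodule.finrank_mono hle).trans ((finrank_range_le_card x).trans (by simp))
  obtain ⟨f, hf, hspan, -⟩ := Submodule.exists_fun_fin_finrank_span_eq K (Set.range v)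
  choose g hg using hf
  obtain ⟨I, hI, hcard⟩ := Finset.exists_superset_card_eq (s := Finset.univ.image g) (n := r)
    (Finset.card_image_le.trans (by simpa using hk.trans htr)) hr
  refine ⟨I, hcard, fun j => ?_⟩
  have hj : v j ∈ Submodule.span K (Set.range f) :=
    hspan.ge (Submodule.subset_span (Set.mem_range_self j))
  refine Submodule.span_mono ?_ hj
  rintro _ ⟨i, rfl⟩
  exact ⟨g i, hI (by simp), hg i⟩

/-- `M` is a symmetric matrix with upper-triangular part `d` whose rows are all combinations of the
rows indexed outside `J`. -/
def IsSpannedSymmLift {n : ℕ} (J : Finset (Fin n)) (d : PairIdx n → ZMod 2)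
    (M : Fin n → Fin n → ZMod 2) : Prop :=
  (∀ i j, M i j = M j i) ∧ (∀ p : PairIdx n, M p.1.1 p.1.2 = d p) ∧
    ∀ j, ∃ c : Fin n → ZMod 2, ∀ k, M j k = ∑ i ∈ Jᶜ, c i * M i k

theorem exists_isSpannedSymmLift_sum_cliqueVec {n s t : ℕ} (hs : s ≤ n) (ht : t ≤ n - s)
    (X : Fin t → Finset (Fin n)) :
    ∃ J ∈ Finset.powersetCard s Finset.univ,
      ∃ M, IsSpannedSymmLift J (∑ i, cliqueVec n (X i)) M := by
  let x : Fin t → Fin n → ZMod 2 := fun i k => if k ∈ X i then 1 else 0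
  let M : Fin n → Fin n → ZMod 2 := fun j => ∑ i, x i j • x i
  obtain ⟨I, hI, hspan⟩ := exists_card_eq_forall_mem_span (K := ZMod 2) M x ht (by simp)
    fun j => Submodule.sum_mem _ fun i _ =>
      Submodule.smul_mem _ _ (Submodule.subset_span (Set.mem_range_self i))
  refine ⟨Iᶜ, ?_, M, ?_, ?_, ?_⟩
  · rw [Finset.mem_powersetCard, Finset.card_compl, hI, Fintype.card_fin]
    exact ⟨Finset.subset_univ _, by omega⟩
  · intro i j
    simp [M, mul_comm]
  · intro p
    simp only [M, x, cliqueVec, Finset.sum_apply, Pi.smul_apply, smul_eq_mul]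
    refine Finset.sum_congr rfl fun i _ => ?_
    split_ifs <;> simp_all
  · intro j
    obtain ⟨c, hc⟩ := (Submodule.mem_span_image_finset_iff_exists_fun (ZMod 2)).1 (hspan j)
    refine ⟨fun i => if hi : i ∈ I then c ⟨i, hi⟩ else 0, fun k => ?_⟩
    rw [← hc, compl_compl, ← Finset.sum_coe_sort I]
    simp

theorem card_filter_isSpannedSymmLift_le {n : ℕ} (J : Finset (Fin n)) :
    (Finset.univ.filter (fun d : PairIdx n → ZMod 2 => ∃ M, IsSpannedSymmLift J d M)).card ≤
      2 ^ (n.choose 2 - J.card.choose 2 + n) := by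
  have hcard : Fintype.card (({p : PairIdx n // ¬ (p.1.1 ∈ J ∧ p.1.2 ∈ J)} → ZMod 2) ×
      (Fin n → ZMod 2)) = 2 ^ (n.choose 2 - J.card.choose 2 + n) := by
    rw [Fintype.card_prod, Fintype.card_fun, Fintype.card_fun, Fintype.card_subtype_compl,
      Fintype.card_subtype, card_pairIdx_filter_mem, card_pairIdx, ZMod.card, Fintype.card_fin,
      pow_add]
  rw [← hcard, ← Fintype.card_coe]
  have hlift : ∀ d : {d // d ∈ Finset.univ.filter
      (fun d : PairIdx n → ZMod 2 => ∃ M, IsSpannedSymmLift J d M)},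
      ∃ M, IsSpannedSymmLift J d.1 M := fun d => (Finset.mem_filter.1 d.2).2
  choose M hsymm hd hspan using hlift
  refine Fintype.card_le_of_injective (fun d => (fun p => d.1 p.1, fun i => M d i i)) ?_
  intro d e hde
  obtain ⟨h1, h2⟩ := Prod.mk.inj hde
  have hp : ∀ p : PairIdx n, ¬ (p.1.1 ∈ J ∧ p.1.2 ∈ J) → M d p.1.1 p.1.2 = M e p.1.1 p.1.2 :=
    fun p hpJ => by rw [hd, hd]; exact congrFun h1 ⟨p, hpJ⟩
  have hMe : M d = M e := by
    refine symm_eq_of_rows_eq Jᶜ _ _ (hsymm d) (hsymm e) (hspan d) (hspan e) fun i hi k => ?_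
    rw [Finset.mem_compl] at hi
    rcases lt_trichotomy i k with h | rfl | h
    · exact hp ⟨(i, k), h⟩ fun hc => hi hc.1
    · exact congrFun h2 i
    · rw [hsymm d, hsymm e]
      exact hp ⟨(k, i), h⟩ fun hc => hi hc.2
  apply Subtype.ext
  funext p
  rw [← hd d p, ← hd e p, hMe]

/-- For every `n ≥ 1` and `0 ≤ s ≤ n`, the number of vectors `d ∈ F_2^{C(n,2)}`
expressible as `d = v_{X_1} + ⋯ + v_{X_t}` for some `t ≤ n - s` and subsets
`X_1, …, X_t ⊆ [n]` is at most `2^{C(n,2)+n} · n^s · 2^{-C(s,2)}`; i.e. every inversion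
ball of radius `n - s` contains at most that many tournaments. -/
theorem inversion_ball_volume (n s : ℕ) (hn : 1 ≤ n) (hs : s ≤ n) :
    ((Finset.univ.filter (fun d : PairIdx n → ZMod 2 =>
        ∃ t ≤ n - s, ∃ Xs : Fin t → Finset (Fin n),
          ∑ i, cliqueVec n (Xs i) = d)).card : ℝ) ≤
      2 ^ (n.choose 2 + n) * (n : ℝ) ^ s * ((2 : ℝ) ^ s.choose 2)⁻¹ := by
  have hsub : Finset.univ.filter (fun d : PairIdx n → ZMod 2 =>
        ∃ t ≤ n - s, ∃ Xs : Fin t → Finset (Fin n), ∑ i, cliqueVec n (Xs i) = d) ⊆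
      (Finset.powersetCard s (Finset.univ : Finset (Fin n))).biUnion fun J =>
        Finset.univ.filter fun d => ∃ M, IsSpannedSymmLift J d M := by
    intro d hd
    obtain ⟨t, ht, X, rfl⟩ := (Finset.mem_filter.1 hd).2
    obtain ⟨J, hJ, hM⟩ := exists_isSpannedSymmLift_sum_cliqueVec hs ht X
    exact Finset.mem_biUnion.2 ⟨J, hJ, Finset.mem_filter.2 ⟨Finset.mem_univ _, hM⟩⟩
  have hnat := (Finset.card_le_card hsub).trans <| Finset.card_biUnion_le_card_mul _ _
    (2 ^ (n.choose 2 - s.choose 2 + n)) fun J hJ => by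
      simpa only [(Finset.mem_powersetCard.1 hJ).2] using card_filter_isSpannedSymmLift_le J
  rw [Finset.card_powersetCard, Finset.card_univ, Fintype.card_fin] at hnat
  have hbound := hnat.trans (Nat.mul_le_mul_right _ (Nat.choose_le_pow n s))
  have hchoose : n.choose 2 + n = (n.choose 2 - s.choose 2 + n) + s.choose 2 := by
    have := Nat.choose_le_choose 2 hs
    omega
  calc _ ≤ (n : ℝ) ^ s * 2 ^ (n.choose 2 - s.choose 2 + n) := by exact_mod_cast hbound
    _ = _ := by
      rw [hchoose, pow_add _ (_ + n)]
      field_simp
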